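/- Let a and b be nonnegative integers with b ≥ 1 and a odd, and let c = a + b. Then the Octopus position [1^a, 2^b | 1^c] with finger count 2 is an R-position: Right has a winning strategy whoever moves first. -/

import Mathlib

namespace Octopus

/-- An Octopus position: the multiset of Left's hand values and the
multiset of Right's hand values. -/
abbrev Pos : Type := Multiset ℕ × Multiset ℕ

/-- All hand values lie in `{1, ..., n}`, where `n` is the finger count. -/
def Valid (n : ℕ) (P : Pos) : Prop :=
  (∀ x ∈ P.1, 1 ≤ x ∧ x ≤ n) ∧ (∀ y ∈ P.2, 1 ≤ y ∧ y ≤ n)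

/-- A move of Left with finger count `n`: Left chooses an attacking hand `x` in
her multiset and a target hand `y` in Right's multiset; that copy of `y` is
replaced by `x + y`, or removed from play if `x + y > n`. -/
def LeftMove (n : ℕ) (P Q : Pos) : Prop :=
  ∃ x ∈ P.1, ∃ y ∈ P.2,
    Q.1 = P.1 ∧
    Q.2 = if x + y ≤ n then (x + y) ::ₘ P.2.erase y else P.2.erase y

/-- A move of Right with finger count `n`: Right chooses an attacking hand `y` in
his multiset and a target hand `x` in Left's multiset; that copy of `x` is
replaced by `x + y`, or removed from play if `x + y > n`. -/
def RightMove (n : ℕ) (P Q : Pos) : Prop :=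
  ∃ x ∈ P.1, ∃ y ∈ P.2,
    Q.2 = P.2 ∧
    Q.1 = if x + y ≤ n then (x + y) ::ₘ P.1.erase x else P.1.erase x

/-- `LeftWinsFirst n P`: Left, moving first from `P`, has a winning strategy
(normal play: a player with no move on their turn loses). -/
inductive LeftWinsFirst (n : ℕ) : Pos → Prop
  | intro (P Q : Pos) (hmove : LeftMove n P Q)
      (hwin : ∀ R, RightMove n Q R → LeftWinsFirst n R) : LeftWinsFirst n P

/-- `RightWinsFirst n P`: Right, moving first from `P`, has a winning strategy. -/
inductive RightWinsFirst (n : ℕ) : Pos → Prop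
  | intro (P Q : Pos) (hmove : RightMove n P Q)
      (hwin : ∀ R, LeftMove n Q R → RightWinsFirst n R) : RightWinsFirst n P

/-- Left, moving second from `P`, has a winning strategy. -/
def LeftWinsSecond (n : ℕ) (P : Pos) : Prop :=
  ∀ Q, RightMove n P Q → LeftWinsFirst n Q

/-- Right, moving second from `P`, has a winning strategy. -/
def RightWinsSecond (n : ℕ) (P : Pos) : Prop :=
  ∀ Q, LeftMove n P Q → RightWinsFirst n Q

/-- `N`-position: whichever player moves first wins. -/
def NPos (n : ℕ) (P : Pos) : Prop := LeftWinsFirst n P ∧ RightWinsFirst n P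

/-- `P`-position: whichever player moves second wins. -/
def PPos (n : ℕ) (P : Pos) : Prop := LeftWinsSecond n P ∧ RightWinsSecond n P

/-- `L`-position: Left wins whoever moves first. -/
def LPos (n : ℕ) (P : Pos) : Prop := LeftWinsFirst n P ∧ LeftWinsSecond n P

/-- `R`-position: Right wins whoever moves first. -/
def RPos (n : ℕ) (P : Pos) : Prop := RightWinsFirst n P ∧ RightWinsSecond n P

/-- The position `[1^a, 2^b | 1^c, 2^d]` (used with finger count 2). -/
def two (a b c d : ℕ) : Pos :=
  (Multiset.replicate a 1 + Multiset.replicate b 2,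
   Multiset.replicate c 1 + Multiset.replicate d 2)

lemma erase_one (a b : ℕ) :
    (Multiset.replicate (a + 1) 1 + Multiset.replicate b 2).erase 1 =
      Multiset.replicate a 1 + Multiset.replicate b 2 := by
  simp [Multiset.replicate_succ]

lemma erase_two (a b : ℕ) :
    (Multiset.replicate a 1 + Multiset.replicate (b + 1) 2).erase 2 =
      Multiset.replicate a 1 + Multiset.replicate b 2 := by
  simp [Multiset.replicate_succ]

lemma mem_hands {a b x : ℕ} (h : x ∈ Multiset.replicate a 1 + Multiset.replicate b 2) :
    (x = 1 ∧ 1 ≤ a) ∨ (x = 2 ∧ 1 ≤ b) := by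
  simp only [Multiset.mem_add, Multiset.mem_replicate] at h
  omega

lemma one_mem_hands (a b : ℕ) :
    1 ∈ Multiset.replicate (a + 1) 1 + Multiset.replicate b 2 := by
  simp [Multiset.mem_replicate]

lemma two_mem_hands (a b : ℕ) :
    2 ∈ Multiset.replicate a 1 + Multiset.replicate (b + 1) 2 := by
  simp [Multiset.mem_replicate]

lemma leftMove_two {a b c d : ℕ} {Q : Pos} (h : LeftMove 2 (two a b c d) Q) :
    (∃ c', c = c' + 1 ∧ 1 ≤ a ∧ Q = two a b c' (d + 1)) ∨
    (∃ c', c = c' + 1 ∧ 1 ≤ b ∧ Q = two a b c' d) ∨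
    (∃ d', d = d' + 1 ∧ 1 ≤ a + b ∧ Q = two a b c d') := by
  obtain ⟨x, hx, y, hy, h₁, h₂⟩ := h
  have hx' := mem_hands hx
  rcases mem_hands hy with ⟨rfl, hc⟩ | ⟨rfl, hd⟩
  · obtain ⟨c, rfl⟩ := Nat.exists_eq_add_of_le' hc
    simp only [two, erase_one] at h₂
    rcases hx' with ⟨rfl, ha⟩ | ⟨rfl, hb⟩
    · refine Or.inl ⟨c, rfl, ha, Prod.ext h₁ ?_⟩
      simpa [two, Multiset.replicate_succ] using h₂
    · exact Or.inr (Or.inl ⟨c, rfl, hb, Prod.ext h₁ (by simpa [two] using h₂)⟩)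
  · obtain ⟨d, rfl⟩ := Nat.exists_eq_add_of_le' hd
    simp only [two, erase_two] at h₂
    rw [if_neg (by omega)] at h₂
    exact Or.inr (Or.inr ⟨d, rfl, by omega, Prod.ext h₁ h₂⟩)

lemma rightMove_one_one (a b c d : ℕ) :
    RightMove 2 (two (a + 1) b (c + 1) d) (two a (b + 1) (c + 1) d) := by
  refine ⟨1, one_mem_hands a b, 1, one_mem_hands c d, rfl, ?_⟩
  simp [two, Multiset.replicate_succ]

lemma rightMove_remove_one (a b c d : ℕ) :
    RightMove 2 (two (a + 1) b c (d + 1)) (two a b c (d + 1)) :=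
  ⟨1, one_mem_hands a b, 2, two_mem_hands c d, rfl, by simp [two]⟩

lemma rightMove_remove_two (a b : ℕ) {c d : ℕ} (h : 1 ≤ c + d) :
    RightMove 2 (two a (b + 1) c d) (two a b c d) := by
  obtain ⟨y, hy, hy'⟩ : ∃ y ∈ (two a b c d).2, 1 ≤ y := by
    rcases c with _ | c
    · obtain ⟨d, rfl⟩ := Nat.exists_eq_add_of_le' (show 1 ≤ d by omega)
      exact ⟨2, two_mem_hands 0 d, by omega⟩
    · exact ⟨1, one_mem_hands c d, le_rfl⟩
  refine ⟨2, two_mem_hands a b, y, hy, rfl, ?_⟩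
  rw [if_neg (by omega)]
  exact (erase_two a b).symm

/-- The positions `[1^a, 2^b | 1^c, 2^d]` with finger count 2 that Right wins moving first. -/
def RightAhead (a b c d : ℕ) : Prop :=
  1 ≤ a + b ∧
  (b = 0 → a ≤ 2 * (c / 2) + d) ∧
  (1 ≤ b → 1 ≤ d → a + b ≤ c + d) ∧
  (1 ≤ b → d = 0 → 2 * (a / 2) + b ≤ c)

/-- Right keeps `RightAhead` as follows: with a `2` of his own he removes a `1` of Left, or a
`2` if Left has no `1`; without one he removes a `2`, or turns a `1` into a `2` if Left has no `2`. -/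
theorem RightAhead.rightWinsFirst {a b c d : ℕ} (h : RightAhead a b c d) :
    RightWinsFirst 2 (two a b c d) := by
  induction hN : 2 * a + b + 2 * c + d using Nat.strong_induction_on generalizing a b c d with
  | _ N ih =>
    subst hN
    have key : ∀ a' b', RightMove 2 (two a b c d) (two a' b' c d) → 2 * a' + b' < 2 * a + b →
        (∀ c', c = c' + 1 → 1 ≤ a' → RightAhead a' b' c' (d + 1)) →
        (∀ c', c = c' + 1 → 1 ≤ b' → RightAhead a' b' c' d) →
        (∀ d', d = d' + 1 → 1 ≤ a' + b' → RightAhead a' b' c d') →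
        RightWinsFirst 2 (two a b c d) := by
      intro a' b' hm hlt h₁ h₂ h₃
      refine ⟨_, _, hm, fun R hR => ?_⟩
      rcases leftMove_two hR with ⟨c', hc, hl, rfl⟩ | ⟨c', hc, hl, rfl⟩ | ⟨d', hd, hl, rfl⟩
      · exact ih _ (by omega) (h₁ c' hc hl) rfl
      · exact ih _ (by omega) (h₂ c' hc hl) rfl
      · exact ih _ (by omega) (h₃ d' hd hl) rfl
    unfold RightAhead at h key
    rcases Nat.eq_zero_or_pos d with rfl | hd
    · rcases Nat.eq_zero_or_pos b with rfl | hb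
      · obtain ⟨a, rfl⟩ := Nat.exists_eq_add_of_le' (show 1 ≤ a by omega)
        obtain ⟨c, rfl⟩ := Nat.exists_eq_add_of_le' (show 1 ≤ c by omega)
        refine key _ _ (rightMove_one_one a 0 c 0) ?_ ?_ ?_ ?_ <;> intros <;> omega
      · obtain ⟨b, rfl⟩ := Nat.exists_eq_add_of_le' hb
        refine key _ _ (rightMove_remove_two a b (by omega)) ?_ ?_ ?_ ?_ <;> intros <;> omega
    · obtain ⟨d, rfl⟩ := Nat.exists_eq_add_of_le' hd
      rcases Nat.eq_zero_or_pos a with rfl | ha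
      · obtain ⟨b, rfl⟩ := Nat.exists_eq_add_of_le' (show 1 ≤ b by omega)
        refine key _ _ (rightMove_remove_two 0 b (by omega)) ?_ ?_ ?_ ?_ <;> intros <;> omega
      · obtain ⟨a, rfl⟩ := Nat.exists_eq_add_of_le' ha
        refine key _ _ (rightMove_remove_one a b c d) ?_ ?_ ?_ ?_ <;> intros <;> omega

/-- for `b ≥ 1`, `a` odd and `c = a + b`, the position
`[1^a, 2^b | 1^c]` with finger count 2 is an R-position. -/
theorem fingerTwo_R_case (a b : ℕ) (hb : 1 ≤ b) (ha : Odd a) :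
    RPos 2 (two a b (a + b) 0) := by
  obtain ⟨k, rfl⟩ := ha
  refine ⟨RightAhead.rightWinsFirst ?_, fun Q hQ => ?_⟩
  · unfold RightAhead
    omega
  · rcases leftMove_two hQ with ⟨c', hc, -, rfl⟩ | ⟨c', hc, -, rfl⟩ | ⟨d', hd, -⟩
    · refine RightAhead.rightWinsFirst ?_
      unfold RightAhead
      omega
    · refine RightAhead.rightWinsFirst ?_
      unfold RightAhead
      omega
    · omega

end Octopus
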